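/- Let k, n ∈ ℕ with 2^{k+1} ≤ n and assume w = ⌊n/2^k⌋ ∈ {2, 3, 4}. Let λ ⊢_o n with Q_2^{(k)}(λ) = (λ_1, …, λ_{2^k}). Then f_k(f_k(λ)) = f_{k+1}(λ) if and only if there is s ∈ {1, …, 2^k} with λ_s ∈ {(w), (1^w)}. -/

import Mathlib

namespace OddSym

open scoped Classical

/-- Remove one box from a row of size `p` (as multisets of parts). -/
def removeBox (lam : Multiset ℕ) (p : ℕ) : Multiset ℕ :=
  if p ≤ 1 then lam.erase p else (p - 1) ::ₘ lam.erase p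

lemma removeBox_sum_lt {lam : Multiset ℕ} {p : ℕ} (hp : p ∈ lam) (h0 : 0 < p) :
    (removeBox lam p).sum < lam.sum := by
  have h : p + (lam.erase p).sum = lam.sum := by
    conv_rhs => rw [← Multiset.cons_erase hp]
    simp [Multiset.sum_cons]
  unfold removeBox
  split
  · omega
  · simp only [Multiset.sum_cons]
    omega

/-- The number of standard Young tableaux of shape `lam`
(equivalently, the degree of the irreducible character of the symmetric
group labelled by `lam`), defined via the branching rule. -/
def degSYT (lam : Multiset ℕ) : ℕ :=
  if _h : lam = 0 then 1
  else ∑ p ∈ (lam.toFinset.filter (fun p => 0 < p)).attach, degSYT (removeBox lam p.1)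
termination_by lam.sum
decreasing_by
  have hp := p.2
  simp only [Finset.mem_filter, Multiset.mem_toFinset] at hp
  exact removeBox_sum_lt hp.1 hp.2

/-- `lam` is an odd partition: all parts positive and the number of standard
Young tableaux of shape `lam` (= the character degree) is odd. -/
def OddP (lam : Multiset ℕ) : Prop :=
  (∀ x ∈ lam, 0 < x) ∧ Odd (degSYT lam)

/-- The parts of `lam` sorted in weakly decreasing order. -/
def descList (lam : Multiset ℕ) : List ℕ :=
  (lam.sort (· ≤ ·)).reverse

/-- The beta-set (set of beta-numbers) of `lam` with `m` beads:
`{ lam_i + (m - i) : 1 ≤ i ≤ m }` where `lam` is padded with zero parts. -/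
def betaSet (lam : Multiset ℕ) (m : ℕ) : Finset ℕ :=
  (Finset.range m).image (fun i => (descList lam).getD i 0 + (m - 1 - i))

/-- `mu` is obtained from `lam` by removing an `e`-hook: in some beta-set of
`lam` a beta-number `x` is replaced by `x - e` (which is not a beta-number). -/
def IsHookRemoval (e : ℕ) (lam mu : Multiset ℕ) : Prop :=
  (∀ x ∈ lam, 0 < x) ∧ (∀ x ∈ mu, 0 < x) ∧ 0 < e ∧
  ∃ m x, Multiset.card lam ≤ m ∧ Multiset.card mu ≤ m ∧
    x ∈ betaSet lam m ∧ e ≤ x ∧ x - e ∉ betaSet lam m ∧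
    betaSet mu m = insert (x - e) ((betaSet lam m).erase x)

/-- The map `f_k` : for an odd partition `lam` with `2^k ≤ |lam|`, the unique
odd partition obtained from `lam` by removing a `2^k`-hook (junk value `0` if
no such partition exists). -/
noncomputable def fkOp (k : ℕ) (lam : Multiset ℕ) : Multiset ℕ :=
  if h : ∃ mu, IsHookRemoval (2 ^ k) lam mu ∧ OddP mu then h.choose else 0

/-- The partition encoded by a finite beta-set: each bead contributes a part
equal to the number of gaps below it. -/
def partOfBeta (S : Finset ℕ) : Multiset ℕ :=
  (S.val.map (fun b => b - (S.filter (fun a => a < b)).card)).filter (fun p => 0 < p)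

/-- The 2-quotient `(lam_0, lam_1)` of `lam`, computed from a beta-set with an
even number of beads via the two runners of the 2-abacus. -/
def quot2 (lam : Multiset ℕ) : Multiset ℕ × Multiset ℕ :=
  (partOfBeta (((betaSet lam (2 * Multiset.card lam)).filter (fun b => b % 2 = 0)).image
      (fun b => b / 2)),
   partOfBeta (((betaSet lam (2 * Multiset.card lam)).filter (fun b => b % 2 = 1)).image
      (fun b => b / 2)))

/-- The `e`-core of `lam`: push all beads of an `e`-abacus configuration for
`lam` up as far as possible. -/
def coreP (e : ℕ) (lam : Multiset ℕ) : Multiset ℕ :=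
  partOfBeta ((Finset.range (e * (Multiset.card lam + e))).filter
    (fun x => x / e <
      ((betaSet lam (Multiset.card lam + e)).filter (fun b => b % e = x % e)).card))

/-- Row `k` of the 2-quotient tower of `lam`: row 0 is `[lam]`, and row `k+1`
replaces each entry of row `k` by its 2-quotient pair. -/
def towerRow : ℕ → Multiset ℕ → List (Multiset ℕ)
  | 0, lam => [lam]
  | (k + 1), lam => (towerRow k lam).flatMap (fun mu => [(quot2 mu).1, (quot2 mu).2])

/-- `R_k^j(lam)`: the component of row `k` of the 2-quotient tower of `lam`
from which a `2^(j-k)`-hook is removed in the passage from `lam` to `f_j(lam)`;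
it is characterized by: row `k` for `f_j(lam)` is obtained from row `k` for
`lam` by replacing this component by its image under `f_(j-k)`. -/
noncomputable def Rcomp (k j : ℕ) (lam : Multiset ℕ) : Multiset ℕ :=
  if h : ∃ s, s < 2 ^ k ∧
      towerRow k (fkOp j lam) =
        (towerRow k lam).set s (fkOp (j - k) ((towerRow k lam).getD s 0))
  then (towerRow k lam).getD h.choose 0 else 0


/-- The part encoded by a bead `b` of `S`: the number of gaps below it. -/
def beadPart (S : Finset ℕ) (b : ℕ) : ℕ := b - (S.filter (fun a => a < b)).card

lemma partOfBeta_eq (S : Finset ℕ) :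
    partOfBeta S = (S.val.map (beadPart S)).filter (fun p => 0 < p) := rfl

lemma partOfBeta_pos (S : Finset ℕ) : ∀ p ∈ partOfBeta S, 0 < p := by
  intro p hp
  rw [partOfBeta_eq, Multiset.mem_filter] at hp
  exact hp.2

lemma partOfBeta_insert_max {S : Finset ℕ} {x : ℕ} (hx : ∀ b ∈ S, b < x) :
    partOfBeta (insert x S) =
      if 0 < x - S.card then (x - S.card) ::ₘ partOfBeta S else partOfBeta S := by
  have hxS : x ∉ S := fun h => lt_irrefl _ (hx x h)
  have h1 : beadPart (insert x S) x = x - S.card := by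
    unfold beadPart
    congr 2
    ext a
    simp only [Finset.mem_filter, Finset.mem_insert]
    grind
  have h2 : S.val.map (beadPart (insert x S)) = S.val.map (beadPart S) := by
    refine Multiset.map_congr rfl fun b hb => ?_
    have hb' := hx b hb
    unfold beadPart
    congr 2
    ext a
    simp only [Finset.mem_filter, Finset.mem_insert]
    grind
  rw [partOfBeta_eq, partOfBeta_eq, Finset.insert_val_of_notMem hxS, Multiset.map_cons, h1, h2,
    Multiset.filter_cons]
  split_ifs <;> simp

lemma card_partOfBeta_le (S : Finset ℕ) : Multiset.card (partOfBeta S) ≤ S.card := by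
  rw [partOfBeta_eq]
  exact (Multiset.card_le_card (Multiset.filter_le _ _)).trans (by simp)

lemma card_le_of_forall_lt {S : Finset ℕ} {x : ℕ} (hx : ∀ b ∈ S, b < x) : S.card ≤ x := by
  simpa using Finset.card_le_card (t := Finset.range x) (fun b hb => by simpa using hx b hb)

lemma partOfBeta_le {S : Finset ℕ} {x : ℕ} (hx : ∀ b ∈ S, b < x) :
    ∀ p ∈ partOfBeta S, p ≤ x - S.card := by
  induction S using Finset.induction_on_max generalizing x with
  | empty => simp [partOfBeta]
  | insert a S ha ih =>
    intro p hp
    have haS : a ∉ S := fun h => lt_irrefl _ (ha a h)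
    rw [partOfBeta_insert_max ha] at hp
    rw [Finset.card_insert_of_notMem haS]
    have hax := hx a (Finset.mem_insert_self _ _)
    split_ifs at hp with h0
    · rcases Multiset.mem_cons.1 hp with rfl | hp
      · omega
      · have := ih ha p hp
        omega
    · have := ih ha p hp
      omega

lemma partOfBeta_range (m : ℕ) : partOfBeta (Finset.range m) = 0 := by
  induction m with
  | zero => simp [partOfBeta]
  | succ m ih =>
    rw [Finset.range_add_one, partOfBeta_insert_max (by simp), ih]
    simp

lemma sum_partOfBeta (S : Finset ℕ) :
    (partOfBeta S).sum + ∑ i ∈ Finset.range S.card, i = ∑ x ∈ S, x := by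
  induction S using Finset.induction_on_max with
  | empty => simp [partOfBeta]
  | insert a S ha ih =>
    have haS : a ∉ S := fun h => lt_irrefl _ (ha a h)
    have := card_le_of_forall_lt ha
    rw [partOfBeta_insert_max ha, Finset.card_insert_of_notMem haS, Finset.sum_range_succ,
      Finset.sum_insert haS, ← ih]
    split_ifs
    · rw [Multiset.sum_cons]
      omega
    · omega

lemma descList_cons {lam : Multiset ℕ} {a : ℕ} (ha : ∀ b ∈ lam, b ≤ a) :
    descList (a ::ₘ lam) = a :: descList lam := by
  unfold descList
  have : (a ::ₘ lam).sort (· ≤ ·) = lam.sort (· ≤ ·) ++ [a] := by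
    refine List.Perm.eq_of_pairwise' (r := (· ≤ ·)) ?_ ?_ ?_
    · exact Multiset.pairwise_sort _ _
    · rw [List.pairwise_append]
      refine ⟨Multiset.pairwise_sort _ _, by simp, ?_⟩
      intro x hx y hy
      simp only [List.mem_singleton] at hy
      subst hy
      exact ha x ((Multiset.mem_sort _).1 hx)
    · rw [← Multiset.coe_eq_coe, Multiset.sort_eq, ← Multiset.coe_add, Multiset.sort_eq]
      rw [add_comm, Multiset.coe_singleton, Multiset.singleton_add]
  rw [this]
  simp

lemma betaSet_cons {lam : Multiset ℕ} {a : ℕ} (ha : ∀ b ∈ lam, b ≤ a) (m : ℕ) :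
    betaSet (a ::ₘ lam) (m + 1) = insert (a + m) (betaSet lam m) := by
  unfold betaSet
  rw [descList_cons ha]
  ext x
  simp only [Finset.mem_image, Finset.mem_range, Finset.mem_insert]
  constructor
  · rintro ⟨i, hi, rfl⟩
    rcases i with _ | i
    · left; simp
    · exact Or.inr ⟨i, by omega, by simp; omega⟩
  · rintro (rfl | ⟨i, hi, rfl⟩)
    · exact ⟨0, by omega, by simp⟩
    · exact ⟨i + 1, by omega, by simp; omega⟩

lemma betaSet_zero (m : ℕ) : betaSet 0 m = Finset.range m := by
  unfold betaSet descList
  ext x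
  simp only [Multiset.sort_zero, List.reverse_nil, List.getD_nil, zero_add, Finset.mem_image,
    Finset.mem_range]
  constructor
  · rintro ⟨i, hi, rfl⟩
    omega
  · intro hx
    exact ⟨m - 1 - x, by omega, by omega⟩

lemma betaSet_partOfBeta (S : Finset ℕ) : betaSet (partOfBeta S) S.card = S := by
  induction S using Finset.induction_on_max with
  | empty => simp [partOfBeta, betaSet]
  | insert a S ha ih =>
    have haS : a ∉ S := fun h => lt_irrefl _ (ha a h)
    have hc := card_le_of_forall_lt ha
    have hle := partOfBeta_le ha
    rw [partOfBeta_insert_max ha, Finset.card_insert_of_notMem haS]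
    split_ifs with h0
    · rw [betaSet_cons hle, ih, Nat.sub_add_cancel hc]
    · have h1 : partOfBeta S = 0 := by
        refine Multiset.eq_zero_of_forall_notMem fun p hp => ?_
        have := hle p hp
        have := partOfBeta_pos S p hp
        omega
      rw [h1, betaSet_zero] at ih ⊢
      have h2 : a = S.card := by omega
      rw [Finset.range_add_one, h2, ih]

/-- Induction on a multiset by adding a maximal element. -/
lemma multiset_induction_on_max {p : Multiset ℕ → Prop} (lam : Multiset ℕ) (h0 : p 0)
    (h1 : ∀ a lam, (∀ b ∈ lam, b ≤ a) → p lam → p (a ::ₘ lam)) : p lam := by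
  induction hn : Multiset.card lam generalizing lam with
  | zero => rw [Multiset.card_eq_zero.1 hn]; exact h0
  | succ n ih =>
    have hne : lam ≠ 0 := by rintro rfl; simp at hn
    obtain ⟨a, ha, hmax⟩ := lam.toFinset.exists_max_image id
      (by simpa [Multiset.toFinset_nonempty] using hne)
    rw [Multiset.mem_toFinset] at ha
    rw [← Multiset.cons_erase ha]
    refine h1 _ _ (fun b hb => ?_) (ih _ ?_)
    · exact hmax b (Multiset.mem_toFinset.2 (Multiset.mem_of_mem_erase hb))
    · rw [Multiset.card_erase_of_mem ha, hn, Nat.pred_succ]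

lemma betaSet_facts {lam : Multiset ℕ} (hpos : ∀ x ∈ lam, 0 < x) {m : ℕ}
    (hm : Multiset.card lam ≤ m) :
    partOfBeta (betaSet lam m) = lam ∧ (betaSet lam m).card = m ∧
      ∀ a, (∀ b ∈ lam, b ≤ a) → ∀ x ∈ betaSet lam m, x < a + m := by
  induction lam using multiset_induction_on_max generalizing m with
  | h0 =>
    rw [betaSet_zero]
    refine ⟨partOfBeta_range m, Finset.card_range m, fun a _ x hx => ?_⟩
    rw [Finset.mem_range] at hx
    omega
  | h1 a lam ha ih =>
    rw [Multiset.card_cons] at hm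
    obtain ⟨m, rfl⟩ : ∃ j, m = j + 1 := ⟨m - 1, by omega⟩
    obtain ⟨h1, h2, h3⟩ := ih (fun x hx => hpos x (Multiset.mem_cons_of_mem hx)) (m := m) (by omega)
    have h4 := h3 a ha
    have ha0 := hpos a (Multiset.mem_cons_self _ _)
    rw [betaSet_cons ha]
    refine ⟨?_, ?_, ?_⟩
    · rw [partOfBeta_insert_max h4, h1, h2, Nat.add_sub_cancel, if_pos ha0]
    · rw [Finset.card_insert_of_notMem (fun h => lt_irrefl _ (h4 _ h)), h2]
    · intro c hc x hx
      have := hc a (Multiset.mem_cons_self _ _)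
      rcases Finset.mem_insert.1 hx with rfl | hx
      · omega
      · have := h4 x hx
        omega

lemma partOfBeta_betaSet {lam : Multiset ℕ} (hpos : ∀ x ∈ lam, 0 < x) {m : ℕ}
    (hm : Multiset.card lam ≤ m) : partOfBeta (betaSet lam m) = lam :=
  (betaSet_facts hpos hm).1

lemma partOfBeta_injective {S T : Finset ℕ} (hc : S.card = T.card)
    (h : partOfBeta S = partOfBeta T) : S = T := by
  rw [← betaSet_partOfBeta S, ← betaSet_partOfBeta T, hc, h]

/-- The bead configuration shifted up by one, with an extra bead at `0`. -/
def addBead (S : Finset ℕ) : Finset ℕ := insert 0 (S.image (· + 1))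

lemma mem_addBead {S : Finset ℕ} {x : ℕ} : x ∈ addBead S ↔ x = 0 ∨ ∃ y ∈ S, y + 1 = x := by
  simp [addBead]

lemma succ_mem_addBead {S : Finset ℕ} {x : ℕ} : x + 1 ∈ addBead S ↔ x ∈ S := by
  simp [addBead]

lemma card_addBead (S : Finset ℕ) : (addBead S).card = S.card + 1 := by
  rw [addBead, Finset.card_insert_of_notMem (by simp),
    Finset.card_image_of_injective _ (add_left_injective 1)]

lemma partOfBeta_addBead (S : Finset ℕ) : partOfBeta (addBead S) = partOfBeta S := by
  induction S using Finset.induction_on_max with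
  | empty => simp [partOfBeta, addBead]
  | insert a S ha ih =>
    have h1 : addBead (insert a S) = insert (a + 1) (addBead S) := by
      ext x; simp only [addBead, Finset.mem_insert, Finset.mem_image]; grind
    have h2 : ∀ b ∈ addBead S, b < a + 1 := by
      intro b hb
      rcases mem_addBead.1 hb with rfl | ⟨y, hy, rfl⟩
      · omega
      · have := ha y hy
        omega
    rw [h1, partOfBeta_insert_max h2, partOfBeta_insert_max ha, ih, card_addBead,
      Nat.add_sub_add_right]

lemma betaSet_succ {lam : Multiset ℕ} (hpos : ∀ x ∈ lam, 0 < x) {m : ℕ}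
    (hm : Multiset.card lam ≤ m) : betaSet lam (m + 1) = addBead (betaSet lam m) := by
  have h1 := betaSet_facts hpos hm
  have h2 := betaSet_facts hpos (hm.trans (Nat.le_succ m))
  apply partOfBeta_injective
  · rw [card_addBead, h1.2.1, h2.2.1]
  · rw [partOfBeta_addBead, h1.1, h2.1]

/-- A function of bead configurations that is invariant under adding a bead only depends on the
encoded partition. -/
lemma eq_of_addBead_invariant {α : Sort*} (F : Finset ℕ → α) (hF : ∀ S, F (addBead S) = F S)
    {S T : Finset ℕ} (h : partOfBeta S = partOfBeta T) : F S = F T := by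
  have key : ∀ (lam : Multiset ℕ), (∀ x ∈ lam, 0 < x) → ∀ m, Multiset.card lam ≤ m →
      F (betaSet lam m) = F (betaSet lam (Multiset.card lam)) := by
    intro lam hpos m hm
    induction m, hm using Nat.le_induction with
    | base => rfl
    | succ m hm ih => rw [betaSet_succ hpos hm, hF, ih]
  rw [← betaSet_partOfBeta S, ← betaSet_partOfBeta T,
    key _ (partOfBeta_pos S) _ (card_partOfBeta_le S),
    key _ (partOfBeta_pos T) _ (card_partOfBeta_le T), h]

/-- The bead configuration obtained by moving the bead `x` down by `e`. -/
def moveBead (S : Finset ℕ) (x e : ℕ) : Finset ℕ := insert (x - e) (S.erase x)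

/-- The beads of `S` that can be moved down by `e`. -/
def movable (e : ℕ) (S : Finset ℕ) : Finset ℕ := S.filter (fun x => e ≤ x ∧ x - e ∉ S)

lemma mem_movable {e x : ℕ} {S : Finset ℕ} : x ∈ movable e S ↔ x ∈ S ∧ e ≤ x ∧ x - e ∉ S := by
  simp [movable]

lemma mem_moveBead {S : Finset ℕ} {x e y : ℕ} :
    y ∈ moveBead S x e ↔ y = x - e ∨ y ≠ x ∧ y ∈ S := by
  simp [moveBead]

lemma card_moveBead {S : Finset ℕ} {x e : ℕ} (hx : x ∈ movable e S) :
    (moveBead S x e).card = S.card := by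
  obtain ⟨h1, -, h3⟩ := mem_movable.1 hx
  rw [moveBead, Finset.card_insert_of_notMem (fun h => h3 (Finset.mem_of_mem_erase h)),
    Finset.card_erase_add_one h1]

lemma sum_moveBead {S : Finset ℕ} {x e : ℕ} (hx : x ∈ movable e S) :
    (partOfBeta (moveBead S x e)).sum + e = (partOfBeta S).sum := by
  obtain ⟨h1, h2, h3⟩ := mem_movable.1 hx
  have ha := sum_partOfBeta S
  have hb := sum_partOfBeta (moveBead S x e)
  rw [card_moveBead hx] at hb
  have hc : ∑ y ∈ moveBead S x e, y + e = ∑ y ∈ S, y := by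
    rw [moveBead, Finset.sum_insert (fun h => h3 (Finset.mem_of_mem_erase h)),
      ← Finset.add_sum_erase S _ h1]
    omega
  omega

lemma movable_addBead_iff {e : ℕ} (he : 0 < e) {S : Finset ℕ} {x : ℕ} :
    x ∈ movable e (addBead S) ↔ ∃ y ∈ movable e S, y + 1 = x := by
  simp only [mem_movable]
  constructor
  · rintro ⟨h1, h2, h3⟩
    have hne : x - e ≠ 0 := fun h => h3 (h ▸ mem_addBead.2 (Or.inl rfl))
    obtain ⟨y, rfl⟩ : ∃ y, x = y + 1 := ⟨x - 1, by omega⟩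
    refine ⟨y, ⟨succ_mem_addBead.1 h1, by omega, fun h => h3 ?_⟩, rfl⟩
    rw [show y + 1 - e = (y - e) + 1 by omega]
    exact succ_mem_addBead.2 h
  · rintro ⟨y, ⟨h1, h2, h3⟩, rfl⟩
    refine ⟨succ_mem_addBead.2 h1, by omega, fun h => h3 ?_⟩
    rw [show y + 1 - e = (y - e) + 1 by omega] at h
    exact succ_mem_addBead.1 h

lemma moveBead_addBead {S : Finset ℕ} {x e : ℕ} (hx : e ≤ x) :
    moveBead (addBead S) (x + 1) e = addBead (moveBead S x e) := by
  ext z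
  rcases z with _ | z
  · rw [mem_moveBead]
    simp [mem_addBead]
  · rw [mem_moveBead, succ_mem_addBead, succ_mem_addBead, mem_moveBead]
    have : z + 1 = x + 1 - e ↔ z = x - e := by omega
    simp [this]

lemma isHookRemoval_iff {e : ℕ} (he : 0 < e) {S : Finset ℕ} {mu : Multiset ℕ} :
    IsHookRemoval e (partOfBeta S) mu ↔
      ∃ x ∈ movable e S, mu = partOfBeta (moveBead S x e) := by
  constructor
  · rintro ⟨hl, hmu, -, m, x, hm1, hm2, hx1, hx2, hx3, hx4⟩
    have key := eq_of_addBead_invariant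
      (fun S => ∃ x ∈ movable e S, mu = partOfBeta (moveBead S x e)) (fun S => ?_)
      (partOfBeta_betaSet hl hm1)
    · rw [← key]
      refine ⟨x, mem_movable.2 ⟨hx1, hx2, hx3⟩, ?_⟩
      rw [moveBead, ← hx4, partOfBeta_betaSet hmu hm2]
    · simp only [movable_addBead_iff he, eq_iff_iff]
      constructor
      · rintro ⟨_, ⟨y, hy, rfl⟩, h⟩
        rw [moveBead_addBead (mem_movable.1 hy).2.1, partOfBeta_addBead] at h
        exact ⟨y, hy, h⟩
      · rintro ⟨y, hy, h⟩
        refine ⟨y + 1, ⟨y, hy, rfl⟩, ?_⟩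
        rw [moveBead_addBead (mem_movable.1 hy).2.1, partOfBeta_addBead, h]
  · rintro ⟨x, hx, rfl⟩
    have hc := card_moveBead hx
    refine ⟨partOfBeta_pos _, partOfBeta_pos _, he, S.card, x, card_partOfBeta_le S,
      hc ▸ card_partOfBeta_le _, ?_⟩
    rw [betaSet_partOfBeta]
    obtain ⟨h1, h2, h3⟩ := mem_movable.1 hx
    refine ⟨h1, h2, h3, ?_⟩
    conv_lhs => rw [← hc]
    rw [betaSet_partOfBeta, moveBead]

lemma partOfBeta_eq_add {S : Finset ℕ} {x : ℕ} (hx : x ∈ S) :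
    partOfBeta S = (if 0 < beadPart S x then {beadPart S x} else 0) +
      ((S.erase x).val.map (beadPart S)).filter (fun p => 0 < p) := by
  conv_lhs => rw [partOfBeta_eq, ← Finset.insert_erase hx]
  rw [Finset.insert_val_of_notMem (Finset.notMem_erase x S), Multiset.map_cons,
    Multiset.filter_cons, Finset.insert_erase hx]

lemma beadPart_pos {S : Finset ℕ} {x : ℕ} (hx : x ∈ movable 1 S) : 0 < beadPart S x := by
  obtain ⟨h1, h2, h3⟩ := mem_movable.1 hx
  have : (S.filter (fun a => a < x)).card ≤ x - 1 := by
    apply card_le_of_forall_lt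
    intro b hb
    rw [Finset.mem_filter] at hb
    have : b ≠ x - 1 := fun h => h3 (h ▸ hb.1)
    omega
  unfold beadPart
  omega

lemma partOfBeta_moveBead_one {S : Finset ℕ} {x : ℕ} (hx : x ∈ movable 1 S) :
    partOfBeta (moveBead S x 1) = removeBox (partOfBeta S) (beadPart S x) := by
  obtain ⟨h1, h2, h3⟩ := mem_movable.1 hx
  have hpos := beadPart_pos hx
  have e1 : (moveBead S x 1).erase (x - 1) = S.erase x := by
    rw [moveBead, Finset.erase_insert (fun h => h3 (Finset.mem_of_mem_erase h))]
  have e2 : beadPart (moveBead S x 1) (x - 1) = beadPart S x - 1 := by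
    have : (moveBead S x 1).filter (fun a => a < x - 1) = S.filter (fun a => a < x) := by
      ext a
      simp only [Finset.mem_filter, mem_moveBead]
      grind
    unfold beadPart
    rw [this]
    omega
  have e3 : (S.erase x).val.map (beadPart (moveBead S x 1)) =
      (S.erase x).val.map (beadPart S) := by
    refine Multiset.map_congr rfl fun b hb => ?_
    rw [Finset.mem_val] at hb
    obtain ⟨hb1, hb2⟩ := Finset.mem_erase.1 hb
    have hb3 : b ≠ x - 1 := fun h => h3 (h ▸ hb2)
    unfold beadPart
    congr 1
    rcases lt_or_ge b x with hlt | hge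
    · congr 1
      ext a
      simp only [Finset.mem_filter, mem_moveBead]
      grind
    · have : (moveBead S x 1).filter (fun a => a < b) =
          moveBead (S.filter (fun a => a < b)) x 1 := by
        ext a
        simp only [Finset.mem_filter, mem_moveBead]
        grind
      rw [this]
      apply card_moveBead
      simp only [mem_movable, Finset.mem_filter]
      refine ⟨⟨h1, by omega⟩, h2, fun h => h3 h.1⟩
  have hmem : x - 1 ∈ moveBead S x 1 := mem_moveBead.2 (Or.inl rfl)
  rw [partOfBeta_eq_add hmem, e1, e2, e3, partOfBeta_eq_add h1, if_pos hpos, removeBox,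
    Multiset.singleton_add, Multiset.erase_cons_head]
  by_cases h : beadPart S x ≤ 1
  · rw [if_pos h, if_neg (by omega), zero_add]
  · rw [if_neg h, if_pos (by omega), Multiset.singleton_add]

lemma beadPart_injOn (S : Finset ℕ) : Set.InjOn (beadPart S) (movable 1 S : Set ℕ) := by
  have key : ∀ x ∈ movable 1 S, ∀ y ∈ movable 1 S, x < y → beadPart S x < beadPart S y := by
    intro x hx y hy hxy
    obtain ⟨hx1, hx2, hx3⟩ := mem_movable.1 hx
    obtain ⟨hy1, hy2, hy3⟩ := mem_movable.1 hy
    have hpos := beadPart_pos hx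
    have h1 : S.filter (fun a => a < y) ⊆
        S.filter (fun a => a < x) ∪ Finset.Ico x (y - 1) := by
      intro a
      simp only [Finset.mem_union, Finset.mem_filter, Finset.mem_Ico]
      grind
    have h2 := (Finset.card_le_card h1).trans (Finset.card_union_le _ _)
    rw [Nat.card_Ico] at h2
    have : x ≠ y - 1 := fun h => hy3 (h ▸ hx1)
    unfold beadPart at hpos ⊢
    omega
  intro x hx y hy h
  rcases lt_trichotomy x y with hlt | heq | hgt
  · exact absurd h (key x hx y hy hlt).ne
  · exact heq
  · exact absurd h (key y hy x hx hgt).ne'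

lemma exists_movable_of_mem {S : Finset ℕ} {p : ℕ} (hp : p ∈ partOfBeta S) :
    ∃ x ∈ movable 1 S, beadPart S x = p := by
  rw [partOfBeta_eq, Multiset.mem_filter, Multiset.mem_map] at hp
  obtain ⟨⟨b, hb, hbp⟩, h0⟩ := hp
  rw [Finset.mem_val] at hb
  induction b using Nat.strong_induction_on with
  | _ b ih =>
    have hb0 : 1 ≤ b := by
      unfold beadPart at hbp
      omega
    by_cases h : b - 1 ∈ S
    · refine ih (b - 1) (by omega) h ?_
      have : S.filter (fun a => a < b) = insert (b - 1) (S.filter (fun a => a < b - 1)) := by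
        ext a
        simp only [Finset.mem_filter, Finset.mem_insert]
        grind
      unfold beadPart at hbp ⊢
      rw [this, Finset.card_insert_of_notMem (by simp)] at hbp
      omega
    · exact ⟨b, mem_movable.2 ⟨hb, hb0, h⟩, hbp⟩

lemma degSYT_partOfBeta {S : Finset ℕ} (hS : partOfBeta S ≠ 0) :
    degSYT (partOfBeta S) = ∑ x ∈ movable 1 S, degSYT (partOfBeta (moveBead S x 1)) := by
  rw [degSYT, dif_neg hS,
    Finset.sum_attach _ (fun p => degSYT (removeBox (partOfBeta S) p))]
  symm
  refine Finset.sum_bij (fun x _ => beadPart S x) (fun x hx => ?_) (fun x hx y hy h => ?_)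
    (fun p hp => ?_) (fun x hx => ?_)
  · have := beadPart_pos hx
    rw [Finset.mem_filter, Multiset.mem_toFinset, partOfBeta_eq_add (mem_movable.1 hx).1,
      if_pos this]
    exact ⟨Multiset.mem_add.2 (Or.inl (Multiset.mem_singleton_self _)), this⟩
  · exact beadPart_injOn S hx hy h
  · rw [Finset.mem_filter, Multiset.mem_toFinset] at hp
    obtain ⟨x, hx, h⟩ := exists_movable_of_mem hp.1
    exact ⟨x, hx, h⟩
  · rw [partOfBeta_moveBead_one hx]

/-- Two successive moves by `e` agree modulo `2` with a single move by `2 * e`. -/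
lemma sum_movable_sum_movable (g : Finset ℕ → ZMod 2) {e : ℕ} (he : 0 < e) (S : Finset ℕ) :
    ∑ x ∈ movable e S, ∑ y ∈ movable e (moveBead S x e), g (moveBead (moveBead S x e) y e) =
      ∑ x ∈ movable (2 * e) S, g (moveBead S x (2 * e)) := by
  have inner : ∀ x ∈ movable e S,
      ∑ y ∈ movable e (moveBead S x e), g (moveBead (moveBead S x e) y e) =
        (if 2 * e ≤ x ∧ x - 2 * e ∉ S then g (moveBead S x (2 * e)) else 0) +
        ((∑ y ∈ S, if x ≠ y ∧ e ≤ y ∧ y - e ∉ S then g (moveBead (moveBead S x e) y e) else 0) +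
         ∑ y ∈ S, if y = x + e then g (moveBead S y (2 * e)) else 0) := by
    intro x hx
    obtain ⟨h1, h2, h3⟩ := mem_movable.1 hx
    rw [movable, Finset.sum_filter]
    nth_rewrite 1 [moveBead]
    rw [Finset.sum_insert (fun h => h3 (Finset.mem_of_mem_erase h))]
    congr 1
    · have e1 : (e ≤ x - e ∧ x - e - e ∉ moveBead S x e) ↔ (2 * e ≤ x ∧ x - 2 * e ∉ S) := by
        rw [mem_moveBead, show x - e - e = x - 2 * e by omega]
        grind
      have e2 : moveBead (moveBead S x e) (x - e) e = moveBead S x (2 * e) := by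
        ext z
        simp only [mem_moveBead]
        grind
      simp only [e1, e2]
    · rw [← Finset.sum_add_distrib, ← Finset.add_sum_erase S _ h1]
      have e0 : x ≠ x + e := by omega
      rw [if_neg (by simp), if_neg e0, zero_add, zero_add]
      refine Finset.sum_congr rfl fun y hy => ?_
      obtain ⟨hyx, hyS⟩ := Finset.mem_erase.1 hy
      by_cases hye : y = x + e
      · subst hye
        have e1 : e ≤ x + e ∧ x + e - e ∉ moveBead S x e := by
          rw [mem_moveBead]
          grind
        have e2 : moveBead (moveBead S x e) (x + e) e = moveBead S (x + e) (2 * e) := by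
          ext z
          simp only [mem_moveBead]
          grind
        rw [if_pos e1, if_pos rfl, if_neg (by simp [h1]), zero_add, e2]
      · have e1 : (e ≤ y ∧ y - e ∉ moveBead S x e) ↔ (x ≠ y ∧ e ≤ y ∧ y - e ∉ S) := by
          rw [mem_moveBead]
          grind
        rw [if_neg hye, add_zero]
        simp only [e1]
  rw [Finset.sum_congr rfl inner, Finset.sum_add_distrib, Finset.sum_add_distrib]
  have cancel : ∑ x ∈ movable e S, ∑ y ∈ S,
      (if x ≠ y ∧ e ≤ y ∧ y - e ∉ S then g (moveBead (moveBead S x e) y e) else 0) = 0 := by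
    have : ∀ x ∈ movable e S, ∑ y ∈ S,
        (if x ≠ y ∧ e ≤ y ∧ y - e ∉ S then g (moveBead (moveBead S x e) y e) else 0) =
        ∑ y ∈ movable e S, if x ≠ y then g (moveBead (moveBead S x e) y e) else 0 := by
      intro x _
      rw [movable, Finset.sum_filter]
      refine Finset.sum_congr rfl fun y _ => ?_
      grind
    rw [Finset.sum_congr rfl this, ← Finset.sum_product']
    refine Finset.sum_involution (fun p _ => (p.2, p.1)) ?_ ?_ ?_ ?_
    · rintro ⟨x, y⟩ hp
      rw [Finset.mem_product, mem_movable, mem_movable] at hp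
      obtain ⟨⟨hx1, hx2, hx3⟩, hy1, hy2, hy3⟩ := hp
      dsimp only at *
      by_cases hxy : x = y
      · simp [hxy]
      · have : moveBead (moveBead S y e) x e = moveBead (moveBead S x e) y e := by
          ext z
          simp only [mem_moveBead]
          grind
        rw [if_pos hxy, if_pos (Ne.symm hxy), this]
        exact CharTwo.add_self_eq_zero _
    · rintro ⟨x, y⟩ _ h heq
      rw [Prod.mk.injEq] at heq
      exact h (if_neg (not_not.2 heq.2))
    · rintro ⟨x, y⟩ hp
      rw [Finset.mem_product] at hp ⊢
      exact hp.symm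
    · rintro ⟨x, y⟩ _
      rfl
  rw [cancel, zero_add, Finset.sum_comm]
  simp only [movable, Finset.sum_filter]
  rw [← Finset.sum_add_distrib]
  refine Finset.sum_congr rfl fun y hy => ?_
  have e1 : (∑ x ∈ S, if e ≤ x ∧ x - e ∉ S then
      (if y = x + e then g (moveBead S y (2 * e)) else 0) else 0) =
      if 2 * e ≤ y ∧ y - e ∈ S ∧ y - 2 * e ∉ S then g (moveBead S y (2 * e)) else 0 := by
    split_ifs with h
    · rw [Finset.sum_eq_single (y - e)]
      · grind
      · grind
      · grind
    · refine Finset.sum_eq_zero fun x hx => ?_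
      grind
  rw [e1]
  grind

/-- The parity of the degree of the partition encoded by `S`. -/
def parity (S : Finset ℕ) : ZMod 2 := (degSYT (partOfBeta S) : ZMod 2)

lemma oddP_partOfBeta {S : Finset ℕ} : OddP (partOfBeta S) ↔ parity S ≠ 0 := by
  unfold OddP parity
  rw [ne_eq, ZMod.natCast_eq_zero_iff_even, Nat.not_even_iff_odd]
  exact ⟨fun h => h.2, fun h => ⟨partOfBeta_pos S, h⟩⟩

lemma parity_eq_sum (k : ℕ) {S : Finset ℕ} (hS : 2 ^ k ≤ (partOfBeta S).sum) :
    parity S = ∑ x ∈ movable (2 ^ k) S, parity (moveBead S x (2 ^ k)) := by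
  induction k generalizing S with
  | zero =>
    have h0 : partOfBeta S ≠ 0 := by
      intro h
      simp [h] at hS
    simp only [parity, pow_zero]
    rw [degSYT_partOfBeta h0, Nat.cast_sum]
  | succ k ih =>
    rw [pow_succ'] at hS ⊢
    rw [ih (by omega), ← sum_movable_sum_movable parity (by positivity)]
    refine Finset.sum_congr rfl fun x hx => ih ?_
    have := sum_moveBead hx
    omega

lemma exists_odd_move {k : ℕ} {S : Finset ℕ} (hS : 2 ^ k ≤ (partOfBeta S).sum)
    (h : parity S ≠ 0) : ∃ x ∈ movable (2 ^ k) S, parity (moveBead S x (2 ^ k)) ≠ 0 := by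
  rw [parity_eq_sum k hS] at h
  exact Finset.exists_ne_zero_of_sum_ne_zero h

lemma fkOp_partOfBeta {k : ℕ} {S Z : Finset ℕ} (hS : 2 ^ k ≤ (partOfBeta S).sum)
    (h : parity S ≠ 0)
    (hZ : ∀ x ∈ movable (2 ^ k) S, parity (moveBead S x (2 ^ k)) ≠ 0 →
      moveBead S x (2 ^ k) = Z) :
    fkOp k (partOfBeta S) = partOfBeta Z ∧ parity Z ≠ 0 := by
  have he : 0 < 2 ^ k := by positivity
  obtain ⟨x, hx, hodd⟩ := exists_odd_move hS h
  have hex : ∃ mu, IsHookRemoval (2 ^ k) (partOfBeta S) mu ∧ OddP mu :=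
    ⟨_, (isHookRemoval_iff he).2 ⟨x, hx, rfl⟩, oddP_partOfBeta.2 hodd⟩
  refine ⟨?_, hZ x hx hodd ▸ hodd⟩
  rw [fkOp, dif_pos hex]
  obtain ⟨h1, h2⟩ := hex.choose_spec
  obtain ⟨y, hy, hmu⟩ := (isHookRemoval_iff he).1 h1
  rw [hmu] at h2 ⊢
  rw [hZ y hy (oddP_partOfBeta.1 h2)]

/-- The runner of residue `r` of the `e`-abacus of `S`. -/
def runner (e r : ℕ) (S : Finset ℕ) : Finset ℕ :=
  (S.filter (fun b => b % e = r)).image (fun b => b / e)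

lemma mem_runner {e r : ℕ} (hr : r < e) {S : Finset ℕ} {z : ℕ} :
    z ∈ runner e r S ↔ r + e * z ∈ S := by
  simp only [runner, Finset.mem_image, Finset.mem_filter]
  constructor
  · rintro ⟨b, ⟨hb, rfl⟩, rfl⟩
    rwa [Nat.mod_add_div]
  · intro h
    refine ⟨_, ⟨h, ?_⟩, ?_⟩
    · rw [Nat.add_mul_mod_self_left, Nat.mod_eq_of_lt hr]
    · rw [Nat.add_mul_div_left _ _ (by omega), Nat.div_eq_of_lt hr, zero_add]

lemma mem_quot2 (S : Finset ℕ) (mu : Multiset ℕ) :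
    (mu = (quot2 (partOfBeta S)).1 ∨ mu = (quot2 (partOfBeta S)).2) ↔
      (mu = partOfBeta (runner 2 0 S) ∨ mu = partOfBeta (runner 2 1 S)) := by
  have h := eq_of_addBead_invariant
    (fun S => mu = partOfBeta (runner 2 0 S) ∨ mu = partOfBeta (runner 2 1 S))
    (fun S => ?_) (partOfBeta_betaSet (partOfBeta_pos S)
      (m := 2 * Multiset.card (partOfBeta S)) (by omega))
  · exact Eq.to_iff h
  · have h0 : runner 2 0 (addBead S) = addBead (runner 2 1 S) := by
      ext z
      rw [mem_runner (by norm_num)]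
      rcases z with _ | z
      · simp [mem_addBead]
      · rw [succ_mem_addBead, mem_runner (by norm_num),
          show 0 + 2 * (z + 1) = (1 + 2 * z) + 1 by ring, succ_mem_addBead]
    have h1 : runner 2 1 (addBead S) = runner 2 0 S := by
      ext z
      rw [mem_runner (by norm_num), mem_runner (by norm_num), add_comm, succ_mem_addBead,
        zero_add]
    rw [h0, h1, partOfBeta_addBead, or_comm]

lemma mem_towerRow (k : ℕ) (S : Finset ℕ) (mu : Multiset ℕ) :
    mu ∈ towerRow k (partOfBeta S) ↔ ∃ r < 2 ^ k, mu = partOfBeta (runner (2 ^ k) r S) := by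
  induction k generalizing mu with
  | zero =>
    have : runner 1 0 S = S := by
      ext z
      rw [mem_runner (by norm_num)]
      simp
    simp [towerRow, this]
  | succ k ih =>
    have comp : ∀ r < 2 ^ k, ∀ b < 2,
        runner 2 b (runner (2 ^ k) r S) = runner (2 ^ (k + 1)) (r + 2 ^ k * b) S := by
      intro r hr b hb
      have hlt : r + 2 ^ k * b < 2 ^ (k + 1) := by
        rw [pow_succ]
        nlinarith
      ext z
      rw [mem_runner hb, mem_runner hr, mem_runner hlt]
      ring_nf
    simp only [towerRow, List.mem_flatMap, List.mem_cons, List.not_mem_nil, or_false]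
    constructor
    · rintro ⟨nu, hnu, h⟩
      obtain ⟨r, hr, rfl⟩ := (ih nu).1 hnu
      rw [mem_quot2, comp r hr 0 (by norm_num), comp r hr 1 (by norm_num)] at h
      rw [pow_succ] at h ⊢
      rcases h with h | h
      · exact ⟨_, by omega, h⟩
      · exact ⟨_, by omega, h⟩
    · rintro ⟨r, hr, rfl⟩
      have hk : 0 < 2 ^ k := by positivity
      have hmod := Nat.mod_lt r hk
      refine ⟨_, (ih _).2 ⟨r % 2 ^ k, hmod, rfl⟩, ?_⟩
      rw [mem_quot2, comp _ hmod 0 (by norm_num), comp _ hmod 1 (by norm_num)]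
      have hdiv := Nat.mod_add_div r (2 ^ k)
      have hd : r / 2 ^ k < 2 := by
        rw [Nat.div_lt_iff_lt_mul hk, ← pow_succ']
        exact hr
      rcases Nat.lt_succ_iff_lt_or_eq.1 hd with h | h
      · left
        rw [← Nat.lt_one_iff.1 h, hdiv]
      · right
        rw [← h, hdiv]

lemma length_towerRow (k : ℕ) (lam : Multiset ℕ) : (towerRow k lam).length = 2 ^ k := by
  induction k with
  | zero => rfl
  | succ k ih => simp [towerRow, List.length_flatMap, ih, pow_succ]

lemma exists_getD_towerRow (k : ℕ) (S : Finset ℕ) (p : Multiset ℕ → Prop) :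
    (∃ s, s < 2 ^ k ∧ p ((towerRow k (partOfBeta S)).getD s 0)) ↔
      ∃ r < 2 ^ k, p (partOfBeta (runner (2 ^ k) r S)) := by
  have hl := length_towerRow k (partOfBeta S)
  constructor
  · rintro ⟨s, hs, h⟩
    rw [List.getD_eq_getElem _ _ (hl ▸ hs)] at h
    obtain ⟨r, hr, he⟩ := (mem_towerRow k S _).1 (List.getElem_mem (hl ▸ hs))
    exact ⟨r, hr, he ▸ h⟩
  · rintro ⟨r, hr, h⟩
    obtain ⟨s, hs, he⟩ := List.mem_iff_getElem.1 ((mem_towerRow k S _).2 ⟨r, hr, rfl⟩)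
    refine ⟨s, hl ▸ hs, ?_⟩
    rwa [List.getD_eq_getElem _ _ hs, he]

lemma partOfBeta_insert_range {w c : ℕ} (hw : 0 < w) :
    partOfBeta (insert (c + w) (Finset.range c)) = {w} := by
  rw [partOfBeta_insert_max (fun b hb => by rw [Finset.mem_range] at hb; omega),
    partOfBeta_range, Finset.card_range, Nat.add_sub_cancel_left, if_pos hw]
  rfl

lemma partOfBeta_erase_range (w c : ℕ) :
    partOfBeta ((Finset.range (c + w + 1)).erase c) = Multiset.replicate w 1 := by
  induction w with
  | zero => rw [add_zero, Finset.range_add_one, Finset.erase_insert (by simp), partOfBeta_range]; rfl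
  | succ w ih =>
    have h1 : (Finset.range (c + (w + 1) + 1)).erase c =
        insert (c + w + 1) ((Finset.range (c + w + 1)).erase c) := by
      ext z
      simp only [Finset.mem_erase, Finset.mem_range, Finset.mem_insert]
      omega
    rw [h1, partOfBeta_insert_max (fun b hb => by simp only [Finset.mem_erase, Finset.mem_range] at hb; omega), ih,
      Finset.card_erase_of_mem (by simp), Finset.card_range, if_pos (by omega),
      Multiset.replicate_succ]
    congr 1
    omega

lemma partOfBeta_eq_singleton {w : ℕ} (hw : 0 < w) {R : Finset ℕ}
    (h : partOfBeta R = {w}) : ∃ c, R = insert (c + w) (Finset.range c) := by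
  have hc := card_partOfBeta_le R
  rw [h, Multiset.card_singleton] at hc
  refine ⟨R.card - 1, partOfBeta_injective ?_ ?_⟩
  · rw [Finset.card_insert_of_notMem (by simp), Finset.card_range]
    omega
  · rw [h, partOfBeta_insert_range hw]

lemma partOfBeta_eq_replicate {w : ℕ} {R : Finset ℕ}
    (h : partOfBeta R = Multiset.replicate w 1) :
    ∃ c, R = (Finset.range (c + w + 1)).erase c := by
  have hc := card_partOfBeta_le R
  rw [h, Multiset.card_replicate] at hc
  refine ⟨R.card - w, partOfBeta_injective ?_ ?_⟩
  · rw [Finset.card_erase_of_mem (by simp), Finset.card_range]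
    omega
  · rw [h, partOfBeta_erase_range]

/-- Some runner of the `e`-abacus of `S` encodes a one-row or one-column partition of `w`. -/
def HasLinearRunner (e w : ℕ) (S : Finset ℕ) : Prop :=
  ∃ r < e, partOfBeta (runner e r S) = {w} ∨
    partOfBeta (runner e r S) = Multiset.replicate w 1

lemma HasLinearRunner.exists_bead {e w : ℕ} (hw : 0 < w) {S : Finset ℕ}
    (h : HasLinearRunner e w S) :
    ∃ x ∈ S, w * e ≤ x ∧
      ((∀ i, 1 ≤ i → i ≤ w → x - i * e ∉ S) ∨
        ((∀ i < w, x - i * e ∈ S) ∧ x - w * e ∉ S)) := by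
  obtain ⟨r, hr, h⟩ := h
  have hsub : ∀ c i : ℕ, i ≤ w → r + e * (c + w) - i * e = r + e * (c + w - i) := by
    intro c i hi
    obtain ⟨j, rfl⟩ : ∃ j, w = j + i := ⟨w - i, by omega⟩
    rw [show r + e * (c + (j + i)) = r + e * (c + j) + i * e by ring,
      show c + (j + i) - i = c + j by omega, Nat.add_sub_cancel]
  have hle : ∀ c : ℕ, w * e ≤ r + e * (c + w) := fun c => by nlinarith [Nat.zero_le (e * c)]
  rcases h with h | h
  · obtain ⟨c, hc⟩ := partOfBeta_eq_singleton hw h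
    refine ⟨r + e * (c + w), ?_, hle c, Or.inl fun i h1 h2 => ?_⟩
    · rw [← mem_runner hr, hc]
      simp
    · rw [hsub c i h2, ← mem_runner hr, hc]
      simp only [Finset.mem_insert, Finset.mem_range]
      omega
  · obtain ⟨c, hc⟩ := partOfBeta_eq_replicate h
    refine ⟨r + e * (c + w), ?_, hle c, Or.inr ⟨fun i h1 => ?_, ?_⟩⟩
    · rw [← mem_runner hr, hc]
      simp
      omega
    · rw [hsub c i h1.le, ← mem_runner hr, hc]
      simp only [Finset.mem_erase, Finset.mem_range]
      omega
    · rw [hsub c w le_rfl, ← mem_runner hr, hc]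
      simp

/-- No bead of `S` can be moved down by `e`. -/
def Flush (e : ℕ) (S : Finset ℕ) : Prop := ∀ x ∈ S, e ≤ x → x - e ∈ S

lemma flush_of_sum_lt {e : ℕ} {S : Finset ℕ} (h : (partOfBeta S).sum < e) : Flush e S := by
  intro x hx he
  by_contra hn
  have := sum_moveBead (mem_movable.2 ⟨hx, he, hn⟩)
  omega

lemma Flush.sub_mul_mem {e : ℕ} {S : Finset ℕ} (hS : Flush e S) {x : ℕ} (hx : x ∈ S) (i : ℕ)
    (hi : e * i ≤ x) : x - e * i ∈ S := by
  induction i with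
  | zero => simpa using hx
  | succ i ih =>
    rw [Nat.mul_succ] at hi ⊢
    have := hS _ (ih (by omega)) (by omega)
    rwa [Nat.sub_sub] at this

lemma Flush.runner_eq {e : ℕ} (he : 0 < e) {S : Finset ℕ} (hS : Flush e S) {t : ℕ} (ht : t ∈ S)
    (ht' : t + e ∉ S) : runner e (t % e) S = Finset.range (t / e + 1) := by
  have hmd := Nat.mod_add_div t e
  ext z
  rw [mem_runner (Nat.mod_lt t he), Finset.mem_range]
  constructor
  · intro h
    by_contra hlt
    obtain ⟨j, rfl⟩ : ∃ j, z = t / e + 1 + j := ⟨z - (t / e + 1), by omega⟩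
    rw [show t % e + e * (t / e + 1 + j) = t + e + e * j by
      rw [mul_add, mul_add]; omega] at h
    have := hS.sub_mul_mem h j (by omega)
    rw [Nat.add_sub_cancel] at this
    exact ht' this
  · intro h
    obtain ⟨j, hj⟩ : ∃ j, t / e = z + j := ⟨t / e - z, by omega⟩
    rw [hj, mul_add] at hmd
    have := hS.sub_mul_mem ht j (by omega)
    rwa [show t - e * j = t % e + e * z by omega] at this

lemma Flush.hasLinearRunner_row {e w : ℕ} (he : 0 < e) (hw : 0 < w) {S : Finset ℕ}
    (hS : Flush e S) {t : ℕ} (ht : t ∈ S) (ht' : t + e ∉ S) :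
    HasLinearRunner e w (insert (t + w * e) (S.erase t)) := by
  have hr := Nat.mod_lt t he
  have hmd := Nat.mod_add_div t e
  refine ⟨t % e, hr, Or.inl ?_⟩
  rw [← partOfBeta_insert_range (c := t / e) hw]
  congr 1
  ext z
  have h1 := Finset.ext_iff.1 (hS.runner_eq he ht ht') z
  rw [mem_runner hr, Finset.mem_range] at h1
  have key : ∀ a, t % e + e * z = t + e * a ↔ z = t / e + a := by
    intro a
    have : t + e * a = t % e + e * (t / e + a) := by rw [mul_add]; omega
    rw [this, Nat.add_left_cancel_iff, Nat.mul_right_inj he.ne']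
  have k0 := key 0
  have kw := key w
  rw [mul_comm e w] at kw
  rw [mem_runner hr, Finset.mem_insert, Finset.mem_insert, Finset.mem_erase, Finset.mem_range,
    kw, h1]
  simp only [mul_zero, add_zero] at k0
  rw [ne_eq, k0]
  omega

lemma Flush.hasLinearRunner_column {e w : ℕ} (he : 0 < e) {S : Finset ℕ}
    (hS : Flush e S) {t : ℕ} (ht : t + w * e ∈ S) (ht' : t + w * e + e ∉ S) :
    HasLinearRunner e (w + 1) (insert (t + w * e + e) (S.erase t)) := by
  have hr := Nat.mod_lt t he
  have hmd := Nat.mod_add_div t e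
  refine ⟨t % e, hr, Or.inr ?_⟩
  rw [← partOfBeta_erase_range (w + 1) (t / e)]
  congr 1
  ext z
  have h1 := Finset.ext_iff.1 (hS.runner_eq he ht ht') z
  rw [Nat.add_mul_mod_self_right, Nat.add_mul_div_right _ _ he, mem_runner hr,
    Finset.mem_range] at h1
  have key : ∀ a, t % e + e * z = t + e * a ↔ z = t / e + a := by
    intro a
    have : t + e * a = t % e + e * (t / e + a) := by rw [mul_add]; omega
    rw [this, Nat.add_left_cancel_iff, Nat.mul_right_inj he.ne']
  have k0 := key 0
  have kw := key (w + 1)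
  rw [show t + e * (w + 1) = t + w * e + e by ring] at kw
  rw [mem_runner hr, Finset.mem_insert, Finset.mem_erase, Finset.mem_erase, Finset.mem_range,
    kw, h1]
  simp only [mul_zero, add_zero] at k0
  rw [ne_eq, k0]
  omega

lemma Flush.two_mul {e : ℕ} {S : Finset ℕ} (hS : Flush e S) : Flush (2 * e) S := by
  intro x hx hle
  have := hS.sub_mul_mem hx 2 (by omega)
  rwa [mul_comm] at this

lemma eq_insert_erase_moveBead {S : Finset ℕ} {s x : ℕ} (hx : x ∈ movable s S) :
    ∃ y ∈ moveBead S x s, y + s ∉ moveBead S x s ∧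
      S = insert (y + s) ((moveBead S x s).erase y) := by
  obtain ⟨h1, h2, h3⟩ := mem_movable.1 hx
  refine ⟨x - s, mem_moveBead.2 (Or.inl rfl), ?_, ?_⟩
  · rw [mem_moveBead]
    grind
  · ext z
    simp only [Finset.mem_insert, Finset.mem_erase, mem_moveBead]
    grind

lemma movable_insert_erase {Y : Finset ℕ} {s a b x : ℕ} (hY : Flush s Y)
    (hb : b ∉ Y) (hx : x ∈ movable s (insert b (Y.erase a))) :
    (s ≤ b ∧ (b - s = a ∨ b - s ∉ Y) ∧
        moveBead (insert b (Y.erase a)) x s = insert (b - s) (Y.erase a)) ∨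
      (a + s ∈ Y ∧ moveBead (insert b (Y.erase a)) x s = insert b (Y.erase (a + s))) := by
  simp only [mem_movable, Finset.mem_insert, Finset.mem_erase] at hx
  obtain ⟨h1, h2, h3⟩ := hx
  by_cases hxb : x = b
  · subst hxb
    refine Or.inl ⟨h2, by grind, ?_⟩
    ext z
    simp only [Finset.mem_insert, Finset.mem_erase, mem_moveBead]
    grind
  · have hxY : x ∈ Y := by grind
    have h4 := hY x hxY h2
    have h5 : x = a + s := by grind
    subst h5
    refine Or.inr ⟨hxY, ?_⟩
    ext z
    simp only [Finset.mem_insert, Finset.mem_erase, mem_moveBead]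
    grind

lemma fkOp_fkOp_eq_iff {k : ℕ} {X Z Z' A : Finset ℕ} (hX : 2 * 2 ^ k ≤ (partOfBeta X).sum)
    (hodd : parity X ≠ 0)
    (h1 : ∀ x ∈ movable (2 ^ k) X, parity (moveBead X x (2 ^ k)) ≠ 0 →
      moveBead X x (2 ^ k) = Z)
    (h2 : ∀ x ∈ movable (2 ^ k) Z, moveBead Z x (2 ^ k) = Z')
    (h3 : ∀ x ∈ movable (2 * 2 ^ k) X, moveBead X x (2 * 2 ^ k) = A) :
    fkOp k (fkOp k (partOfBeta X)) = fkOp (k + 1) (partOfBeta X) ↔ Z' = A := by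
  obtain ⟨x, hx, hxo⟩ := exists_odd_move (k := k) (by omega) hodd
  obtain rfl := h1 x hx hxo
  have hs := sum_moveBead hx
  have hc := card_moveBead hx
  obtain ⟨y, hy, hyo⟩ := exists_odd_move (k := k) (by omega) hxo
  obtain rfl := h2 y hy
  have hc' := card_moveBead hy
  obtain ⟨z, hz, hzo⟩ := exists_odd_move (k := k + 1) (by rwa [pow_succ']) hodd
  rw [pow_succ'] at hz hzo
  obtain rfl := h3 z hz
  have hc'' := card_moveBead hz
  rw [(fkOp_partOfBeta (k := k) (by omega) hodd h1).1,
    (fkOp_partOfBeta (k := k) (by omega) hxo fun v hv _ => h2 v hv).1,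
    (fkOp_partOfBeta (k := k + 1) (by rwa [pow_succ']) hodd
      fun v hv _ => by rw [pow_succ'] at hv ⊢; exact h3 v hv).1]
  exact ⟨fun h => partOfBeta_injective (by omega) h, fun h => by rw [h]⟩

lemma movable_nonempty_of_odd {k : ℕ} {X : Finset ℕ} {x : ℕ}
    (hX : 3 * 2 ^ k ≤ (partOfBeta X).sum) (hx : x ∈ movable (2 ^ k) X)
    (hodd : parity (moveBead X x (2 ^ k)) ≠ 0) :
    ∃ y, y ∈ movable (2 * 2 ^ k) (moveBead X x (2 ^ k)) := by
  have := sum_moveBead hx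
  obtain ⟨y, hy, -⟩ := exists_odd_move (k := k + 1) (by rw [pow_succ']; omega) hodd
  rw [pow_succ'] at hy
  exact ⟨y, hy⟩

lemma fkOp_fkOp_eq_iff_of_weight_two {k : ℕ} {X : Finset ℕ}
    (h1 : 2 * 2 ^ k ≤ (partOfBeta X).sum) (h2 : (partOfBeta X).sum < 3 * 2 ^ k)
    (hodd : parity X ≠ 0) :
    fkOp k (fkOp k (partOfBeta X)) = fkOp (k + 1) (partOfBeta X) ↔
      HasLinearRunner (2 ^ k) 2 X := by
  obtain ⟨x, hx, -⟩ := exists_odd_move (k := k + 1) (by rwa [pow_succ']) hodd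
  rw [pow_succ'] at hx
  have hs := sum_moveBead hx
  obtain ⟨y, hy, hyn, hXY⟩ := eq_insert_erase_moveBead hx
  generalize moveBead X x (2 * 2 ^ k) = Y at hs hy hyn hXY
  have hY : Flush (2 ^ k) Y := flush_of_sum_lt (by omega)
  have he : 0 < 2 ^ k := by positivity
  subst hXY
  have hA : ∀ x ∈ movable (2 * 2 ^ k) (insert (y + 2 * 2 ^ k) (Y.erase y)),
      moveBead (insert (y + 2 * 2 ^ k) (Y.erase y)) x (2 * 2 ^ k) = Y := by
    intro v hv
    rcases movable_insert_erase hY.two_mul hyn hv with ⟨-, -, h⟩ | ⟨h, -⟩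
    · rw [h, Nat.add_sub_cancel, Finset.insert_erase hy]
    · exact absurd h hyn
  by_cases hy1 : y + 2 ^ k ∈ Y
  · have hlin := hY.hasLinearRunner_column he (w := 1) (t := y) (by rwa [one_mul])
      (by rwa [one_mul, add_assoc, ← two_mul])
    rw [show y + 1 * 2 ^ k + 2 ^ k = y + 2 * 2 ^ k by omega] at hlin
    rw [iff_true_right hlin,
      fkOp_fkOp_eq_iff (Z := insert (y + 2 * 2 ^ k) (Y.erase (y + 2 ^ k))) (Z' := Y) h1 hodd
        (fun v hv _ => ?_) (fun v hv => ?_) hA]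
    · rcases movable_insert_erase hY hyn hv with ⟨-, h, -⟩ | ⟨-, h⟩
      · rw [show y + 2 * 2 ^ k - 2 ^ k = y + 2 ^ k by omega] at h
        exact absurd h (by simp [hy1])
      · exact h
    · rcases movable_insert_erase hY hyn hv with ⟨-, -, h⟩ | ⟨h, -⟩
      · rw [h, show y + 2 * 2 ^ k - 2 ^ k = y + 2 ^ k by omega, Finset.insert_erase hy1]
      · rw [add_assoc, ← two_mul] at h
        exact absurd h hyn
  · have hlin := hY.hasLinearRunner_row he (w := 2) (by norm_num) hy hy1
    rw [iff_true_right hlin,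
      fkOp_fkOp_eq_iff (Z := insert (y + 2 ^ k) (Y.erase y)) (Z' := Y) h1 hodd
        (fun v hv _ => ?_) (fun v hv => ?_) hA]
    · rcases movable_insert_erase hY hyn hv with ⟨-, -, h⟩ | ⟨h, -⟩
      · rwa [show y + 2 * 2 ^ k - 2 ^ k = y + 2 ^ k by omega] at h
      · exact absurd h hy1
    · rcases movable_insert_erase hY hy1 hv with ⟨-, -, h⟩ | ⟨h, -⟩
      · rw [h, Nat.add_sub_cancel, Finset.insert_erase hy]
      · exact absurd h hy1

lemma not_hasLinearRunner_of_interior {e y i : ℕ} {Y : Finset ℕ} (he : 0 < e) (hY : Flush e Y)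
    (hi : 1 ≤ i) (hi' : i ≤ 2) (hy : y + i * e ∈ Y) (hyn : y + i * e + e ∉ Y) :
    ¬ HasLinearRunner e 4 (insert (y + 4 * e) (Y.erase y)) := by
  intro h
  have hb : y + 4 * e ∉ Y := by
    intro h4
    rcases (show i = 1 ∨ i = 2 by omega) with rfl | rfl
    · have := hY.sub_mul_mem h4 2 (by omega)
      rw [show y + 4 * e - e * 2 = y + 1 * e + e by omega] at this
      exact hyn this
    · have := hY.sub_mul_mem h4 1 (by omega)
      rw [show y + 4 * e - e * 1 = y + 2 * e + e by omega] at this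
      exact hyn this
  obtain ⟨x, hx, hle, h⟩ := h.exists_bead (by norm_num)
  simp only [Finset.mem_insert, Finset.mem_erase] at hx h
  rcases h with h | ⟨h, h'⟩
  · have a1 := h 1 (by norm_num) (by norm_num)
    have a2 := h 2 (by norm_num) (by norm_num)
    have a4 := h (4 - i) (by omega) (by omega)
    by_cases hxb : x = y + 4 * e
    · subst hxb
      rcases (show i = 1 ∨ i = 2 by omega) with rfl | rfl
      · rw [show y + 4 * e - (4 - 1) * e = y + 1 * e by omega] at a4
        grind
      · rw [show y + 4 * e - (4 - 2) * e = y + 2 * e by omega] at a4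
        grind
    · have hxY : x ∈ Y := by grind
      have b1 := hY x hxY (by omega)
      have b2 := hY _ b1 (by omega)
      grind
  · have a0 := h 0 (by norm_num)
    have a1 := h 1 (by norm_num)
    have a2 := h 2 (by norm_num)
    by_cases hxb : x = y + 4 * e
    · subst hxb
      rcases (show i = 1 ∨ i = 2 by omega) with rfl | rfl
      · rw [show y + 4 * e - 2 * e = y + 1 * e + e by omega] at a2
        grind
      · rw [show y + 4 * e - 1 * e = y + 2 * e + e by omega] at a1
        grind
    · have hxY : x ∈ Y := by grind
      have b4 := hY.sub_mul_mem hxY 4 (by omega)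
      rw [mul_comm] at b4
      grind

lemma fkOp_fkOp_eq_iff_of_weight_four {k : ℕ} {X : Finset ℕ}
    (h1 : 4 * 2 ^ k ≤ (partOfBeta X).sum) (h2 : (partOfBeta X).sum < 5 * 2 ^ k)
    (hodd : parity X ≠ 0) :
    fkOp k (fkOp k (partOfBeta X)) = fkOp (k + 1) (partOfBeta X) ↔
      HasLinearRunner (2 ^ k) 4 X := by
  have hpow : 2 ^ (k + 2) = 4 * 2 ^ k := by ring
  obtain ⟨x, hx, -⟩ := exists_odd_move (k := k + 2) (by rwa [hpow]) hodd
  rw [hpow] at hx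
  have hs := sum_moveBead hx
  obtain ⟨y, hy, hyn, hXY⟩ := eq_insert_erase_moveBead hx
  generalize moveBead X x (4 * 2 ^ k) = Y at hs hy hyn hXY
  have hY : Flush (2 ^ k) Y := flush_of_sum_lt (by omega)
  have he : 0 < 2 ^ k := by positivity
  have hdown : ∀ i, y + i * 2 ^ k + 2 ^ k ∈ Y → y + i * 2 ^ k ∈ Y := by
    intro i hi
    have := hY _ hi (by omega)
    rwa [Nat.add_sub_cancel] at this
  have d1 := hdown 1
  have d2 := hdown 2
  have hne : ∀ x ∈ movable (2 ^ k) X, parity (moveBead X x (2 ^ k)) ≠ 0 →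
      ∃ y, y ∈ movable (2 * 2 ^ k) (moveBead X x (2 ^ k)) :=
    fun x hx => movable_nonempty_of_odd (by omega) hx
  have main := fun Z Z' A => fkOp_fkOp_eq_iff (k := k) (X := X) (Z := Z) (Z' := Z') (A := A)
    (by omega) hodd
  have hrow := hY.hasLinearRunner_row he (w := 4) (by norm_num) hy
  have hcol := hY.hasLinearRunner_column he (w := 3) (t := y)
  have hnot1 := not_hasLinearRunner_of_interior (y := y) (i := 1) he hY
  have hnot2 := not_hasLinearRunner_of_interior (y := y) (i := 2) he hY
  clear hs h1 h2 hodd hx hpow hdown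
  subst hXY
  generalize 2 ^ k = e at *
  have c1 : y + 1 * e = y + e := by omega
  have c2 : y + e + e = y + 2 * e := by omega
  have c3 : y + 2 * e + e = y + 3 * e := by omega
  have c4 : y + 3 * e + e = y + 4 * e := by omega
  have s1 : y + 4 * e - e = y + 3 * e := by omega
  have s2 : y + 4 * e - 2 * e = y + 2 * e := by omega
  have s3 : y + 3 * e - 2 * e = y + e := by omega
  have s4 : y + 3 * e - e = y + 2 * e := by omega
  have s5 : y + e + 2 * e = y + 3 * e := by omega
  simp only [c1, c2, c3, c4] at d1 d2 hrow hcol hnot1 hnot2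
  by_cases hy1 : y + e ∈ Y
  · by_cases hy2 : y + 2 * e ∈ Y
    · by_cases hy3 : y + 3 * e ∈ Y
      · rw [iff_true_right (hcol hy3 hyn),
          main (insert (y + 4 * e) (Y.erase (y + e))) (insert (y + 4 * e) (Y.erase (y + 2 * e)))
            (insert (y + 4 * e) (Y.erase (y + 2 * e))) ?_ ?_ ?_]
        · intro v hv _
          rcases movable_insert_erase hY hyn hv with h | h
          · grind
          · exact h.2
        · intro v hv
          rcases movable_insert_erase hY hyn hv with h | h
          · grind
          · rw [h.2, c2]
        · intro v hv
          rcases movable_insert_erase hY.two_mul hyn hv with h | h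
          · grind
          · exact h.2
      · rw [iff_false_right (hnot2 (by norm_num) (by norm_num) hy2 hy3),
          main (insert (y + 3 * e) (Y.erase y)) (insert (y + 3 * e) (Y.erase (y + e)))
            (insert (y + 4 * e) (Y.erase (y + 2 * e))) ?_ ?_ ?_]
        · intro h
          have := Finset.ext_iff.1 h (y + 4 * e)
          grind
        · intro v hv ho
          obtain ⟨u, hu⟩ := hne v hv ho
          rcases movable_insert_erase hY hyn hv with h | h
          · rw [h.2.2, s1]
          · rw [h.2] at hu
            rcases movable_insert_erase hY.two_mul hyn hu with h' | h'
            · grind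
            · grind
        · intro v hv
          rcases movable_insert_erase hY hy3 hv with h | h
          · grind
          · rw [h.2]
        · intro v hv
          rcases movable_insert_erase hY.two_mul hyn hv with h | h
          · grind
          · exact h.2
    · have hy3 : y + 3 * e ∉ Y := fun h => hy2 (d2 h)
      rw [iff_false_right (hnot1 (by norm_num) (by norm_num) hy1 hy2),
        main (insert (y + 4 * e) (Y.erase (y + e))) (insert (y + 3 * e) (Y.erase (y + e)))
          (insert (y + 2 * e) (Y.erase y)) ?_ ?_ ?_]
      · intro h
        have := Finset.ext_iff.1 h (y + 3 * e)
        grind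
      · intro v hv ho
        obtain ⟨u, hu⟩ := hne v hv ho
        rcases movable_insert_erase hY hyn hv with h | h
        · rw [h.2.2, s1] at hu
          rcases movable_insert_erase hY.two_mul hy3 hu with h' | h'
          · grind
          · grind
        · exact h.2
      · intro v hv
        rcases movable_insert_erase hY hyn hv with h | h
        · rw [h.2.2, s1]
        · grind
      · intro v hv
        rcases movable_insert_erase hY.two_mul hyn hv with h | h
        · rw [h.2.2, s2]
        · grind
  · have hy2 : y + 2 * e ∉ Y := fun h => hy1 (d1 h)
    have hy3 : y + 3 * e ∉ Y := fun h => hy2 (d2 h)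
    rw [iff_true_right (hrow hy1),
      main (insert (y + 3 * e) (Y.erase y)) (insert (y + 2 * e) (Y.erase y))
        (insert (y + 2 * e) (Y.erase y)) ?_ ?_ ?_]
    · intro v hv _
      rcases movable_insert_erase hY hyn hv with h | h
      · rw [h.2.2, s1]
      · grind
    · intro v hv
      rcases movable_insert_erase hY hy3 hv with h | h
      · rw [h.2.2, s4]
      · grind
    · intro v hv
      rcases movable_insert_erase hY.two_mul hyn hv with h | h
      · rw [h.2.2, s2]
      · grind

lemma fkOp_fkOp_eq_iff_of_weight_three {k : ℕ} {X : Finset ℕ}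
    (h1 : 3 * 2 ^ k ≤ (partOfBeta X).sum) (h2 : (partOfBeta X).sum < 4 * 2 ^ k)
    (hodd : parity X ≠ 0) :
    fkOp k (fkOp k (partOfBeta X)) = fkOp (k + 1) (partOfBeta X) ↔
      HasLinearRunner (2 ^ k) 3 X := by
  obtain ⟨x, hx, hxo⟩ := exists_odd_move (k := k + 1) (by rw [pow_succ']; omega) hodd
  rw [pow_succ'] at hx hxo
  have hs := sum_moveBead hx
  obtain ⟨a, ha, han, hXB⟩ := eq_insert_erase_moveBead hx
  generalize moveBead X x (2 * 2 ^ k) = B at hs ha han hXB hxo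
  obtain ⟨x', hx', -⟩ := exists_odd_move (k := k) (by omega) hxo
  have hs' := sum_moveBead hx'
  obtain ⟨t, ht, htn, hBY⟩ := eq_insert_erase_moveBead hx'
  generalize moveBead B x' (2 ^ k) = Y at hs' ht htn hBY
  have hY : Flush (2 ^ k) Y := flush_of_sum_lt (by omega)
  have he : 0 < 2 ^ k := by positivity
  have hne : ∀ x ∈ movable (2 ^ k) X, parity (moveBead X x (2 ^ k)) ≠ 0 →
      ∃ y, y ∈ movable (2 * 2 ^ k) (moveBead X x (2 ^ k)) :=
    fun x hx => movable_nonempty_of_odd (by omega) hx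
  have main := fun Z Z' A => fkOp_fkOp_eq_iff (k := k) (X := X) (Z := Z) (Z' := Z') (A := A)
    (by omega) hodd
  clear hs hs' h1 h2 hodd hx hx' hxo
  subst hBY
  generalize 2 ^ k = e at *
  by_cases hat : a = t + e
  · have hX : X = insert (t + 3 * e) (Y.erase t) := by
      subst hXB hat
      ext z
      simp only [Finset.mem_insert, Finset.mem_erase]
      grind
    have ht3 : t + 3 * e ∉ Y := fun h => by
      have := hY.sub_mul_mem h 2 (by omega)
      rw [show t + 3 * e - e * 2 = t + e by omega] at this
      exact htn this
    have ht2 : t + 2 * e ∉ Y := fun h => by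
      have := hY.sub_mul_mem h 1 (by omega)
      rw [show t + 2 * e - e * 1 = t + e by omega] at this
      exact htn this
    rw [iff_true_right (hX ▸ hY.hasLinearRunner_row he (by norm_num) ht htn),
      main (insert (t + 2 * e) (Y.erase t)) (insert (t + e) (Y.erase t))
        (insert (t + e) (Y.erase t)) ?_ ?_ ?_]
    · rw [hX]
      intro v hv _
      rcases movable_insert_erase hY ht3 hv with h | h
      · rw [h.2.2]
        congr 1
        omega
      · grind
    · intro v hv
      rcases movable_insert_erase hY ht2 hv with h | h
      · rw [h.2.2]
        congr 1
        omega
      · grind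
    · rw [hX]
      intro v hv
      rcases movable_insert_erase hY.two_mul ht3 hv with h | h
      · rw [h.2.2]
        congr 1
        omega
      · grind
  by_cases hat2 : a + 2 * e = t
  · subst hat2
    have haY : a ∈ Y := by grind
    have h3 : a + 2 * e + e = a + 3 * e := by omega
    rw [h3] at htn hXB
    have hX : X = insert (a + 3 * e) (Y.erase a) := by
      subst hXB
      ext z
      simp only [Finset.mem_insert, Finset.mem_erase]
      grind
    have hcol := hY.hasLinearRunner_column he (w := 2) ht (by rwa [h3])
    rw [h3] at hcol
    have ha1 : a + e ∈ Y := by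
      have := hY _ ht (by omega)
      rwa [show a + 2 * e - e = a + e by omega] at this
    rw [iff_true_right (hX ▸ hcol),
      main (insert (a + 3 * e) (Y.erase (a + e))) (insert (a + 3 * e) (Y.erase (a + 2 * e)))
        (insert (a + 3 * e) (Y.erase (a + 2 * e))) ?_ ?_ ?_]
    · rw [hX]
      intro v hv _
      rcases movable_insert_erase hY htn hv with h | h
      · grind
      · exact h.2
    · intro v hv
      rcases movable_insert_erase hY htn hv with h | h
      · grind
      · rw [h.2, add_assoc, ← two_mul]
    · rw [hX]
      intro v hv
      rcases movable_insert_erase hY.two_mul htn hv with h | h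
      · grind
      · exact h.2
  have haY : a ∈ Y := by grind
  have hat' : a ≠ t := by grind
  have hane : a + e ≠ t := by grind
  have ha2 : a + 2 * e ∉ Y := by grind
  have ht2 : t + 2 * e ∉ Y := fun h => by
    have := hY _ h (by omega)
    rw [show t + 2 * e - e = t + e by omega] at this
    exact htn this
  have hXmem : ∀ z, z ∈ X ↔ z = a + 2 * e ∨ z ≠ a ∧ (z = t + e ∨ z ≠ t ∧ z ∈ Y) := by
    intro z
    rw [hXB]
    simp only [Finset.mem_insert, Finset.mem_erase]
  have h2Y := hY.two_mul
  have hlin : ¬ HasLinearRunner e 3 X := by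
    intro h
    obtain ⟨x, hx, hle, h⟩ := h.exists_bead (by norm_num)
    rcases h with h | ⟨h, h'⟩
    · have b1 := h 1 (by norm_num) (by norm_num)
      have b2 := h 2 (by norm_num) (by norm_num)
      have b3 := h 3 (by norm_num) (by norm_num)
      rw [hXmem] at hx b1 b2 b3
      rcases hx with rfl | ⟨hxa, rfl | ⟨hxt, hxY⟩⟩
      · have c := hY a haY (by omega)
        rw [show a + 2 * e - 3 * e = a - e by omega] at b3
        have hae : a - e = t := by
          by_contra hn
          exact b3 (Or.inr ⟨by omega, Or.inr ⟨hn, c⟩⟩)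
        omega
      · have c := hY t ht (by omega)
        rw [show t + e - 2 * e = t - e by omega] at b2
        exact b2 (Or.inr ⟨by omega, Or.inr ⟨by omega, c⟩⟩)
      · have c1 := hY x hxY (by omega)
        have c2 := hY _ c1 (by omega)
        have c3 := hY _ c2 (by omega)
        grind
    · have b0 := h 0 (by norm_num)
      have b1 := h 1 (by norm_num)
      have b2 := h 2 (by norm_num)
      rw [hXmem] at hx b0 b1 b2 h'
      rcases hx with rfl | ⟨hxa, rfl | ⟨hxt, hxY⟩⟩
      · grind
      · grind
      · have c1 := hY x hxY (by omega)
        have c2 := hY _ c1 (by omega)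
        have c3 := hY _ c2 (by omega)
        grind
  have hB : ∀ c ∈ Y, c + e ∉ Y → c ≠ t →
      ∀ v, v ∉ movable (2 * e) (insert (c + e) ((insert (t + e) (Y.erase t)).erase c)) := by
    intro c hc hcn hct v hv
    simp only [mem_movable, Finset.mem_insert, Finset.mem_erase] at hv
    obtain ⟨hv1, hv2, hv3⟩ := hv
    rcases hv1 with rfl | ⟨hvc, rfl | ⟨hvt, hvY⟩⟩
    · have c1 := hY c hc (by omega)
      rw [show c + e - 2 * e = c - e by omega] at hv3
      have hce : c - e = t := by
        by_contra hn
        exact hv3 (Or.inr ⟨by omega, Or.inr ⟨hn, c1⟩⟩)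
      exact htn (by rwa [show t + e = c by omega])
    · have c1 := hY t ht (by omega)
      rw [show t + e - 2 * e = t - e by omega] at hv3
      have hce : t - e = c := by
        by_contra hn
        exact hv3 (Or.inr ⟨hn, Or.inr ⟨by omega, c1⟩⟩)
      exact hcn (by rwa [show c + e = t by omega])
    · have c1 := hY v hvY (by omega)
      have c2 := hY _ c1 (by omega)
      grind
  rw [iff_false_right hlin]
  have hZ : ∀ v ∈ movable e X, parity (moveBead X v e) ≠ 0 →
      moveBead X v e = insert (a + 2 * e) (Y.erase a) := by
    intro v hv ho
    obtain ⟨u, hu⟩ := hne v hv ho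
    rw [mem_movable, hXmem, hXmem] at hv
    obtain ⟨hv1, hv2, hv3⟩ := hv
    by_cases hvt : v = t + e
    · ext z
      simp only [mem_moveBead, hXmem, Finset.mem_insert, Finset.mem_erase]
      grind
    exfalso
    by_cases hva : v = a + 2 * e
    · have ha1 : a + e ∉ Y := by grind
      refine hB a haY ha1 hat' u ?_
      convert hu using 2
      ext z
      simp only [mem_moveBead, hXmem, Finset.mem_insert, Finset.mem_erase]
      grind
    · have hvY : v ∈ Y := by grind
      have hv' := hY v hvY hv2
      have hvae : v = a + e := by grind
      refine hB v hvY (by grind) (by grind) u ?_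
      convert hu using 2
      ext z
      simp only [mem_moveBead, hXmem, Finset.mem_insert, Finset.mem_erase]
      grind
  have hA : ∀ v ∈ movable (2 * e) X, moveBead X v (2 * e) = insert (t + e) (Y.erase t) := by
    intro v hv
    rw [mem_movable, hXmem, hXmem] at hv
    obtain ⟨hv1, hv2, hv3⟩ := hv
    have hva : v = a + 2 * e := by
      rcases hv1 with rfl | ⟨hvc, rfl | ⟨hvt, hvY⟩⟩
      · rfl
      · have := hY t ht (by omega)
        grind
      · have := h2Y v hvY hv2
        grind
    ext z
    simp only [mem_moveBead, hXmem, Finset.mem_insert, Finset.mem_erase]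
    grind
  by_cases ha1 : a + e ∈ Y
  · rw [main _ (insert (a + 2 * e) (Y.erase (a + e))) _ hZ ?_ hA]
    · intro h
      have := Finset.ext_iff.1 h (t + e)
      grind
    · intro v hv
      rcases movable_insert_erase hY ha2 hv with h | h
      · grind
      · exact h.2
  · rw [main _ (insert (a + e) (Y.erase a)) _ hZ ?_ hA]
    · intro h
      have := Finset.ext_iff.1 h (t + e)
      grind
    · intro v hv
      rcases movable_insert_erase hY ha2 hv with h | h
      · rw [h.2.2]
        congr 1
        omega
      · exact absurd h.1 ha1

theorem stmt15 (k n : ℕ) (h : 2 ^ (k + 1) ≤ n)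
    (hw : n / 2 ^ k = 2 ∨ n / 2 ^ k = 3 ∨ n / 2 ^ k = 4)
    (lam : Multiset ℕ) (hodd : OddP lam) (hsum : lam.sum = n) :
    fkOp k (fkOp k lam) = fkOp (k + 1) lam ↔
      ∃ s, s < 2 ^ k ∧
        ((towerRow k lam).getD s 0 = {n / 2 ^ k} ∨
          (towerRow k lam).getD s 0 = Multiset.replicate (n / 2 ^ k) 1) := by
  have hP := partOfBeta_betaSet hodd.1 (le_refl (Multiset.card lam))
  generalize betaSet lam (Multiset.card lam) = X at hP
  subst hP
  have hX := oddP_partOfBeta.1 hodd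
  have he : 0 < 2 ^ k := by positivity
  rw [exists_getD_towerRow k X
    (fun mu => mu = {n / 2 ^ k} ∨ mu = Multiset.replicate (n / 2 ^ k) 1)]
  have hlo := Nat.div_mul_le_self n (2 ^ k)
  have hhi := Nat.lt_div_mul_add (a := n) he
  generalize n / 2 ^ k = w at *
  rcases hw with rfl | rfl | rfl
  · exact fkOp_fkOp_eq_iff_of_weight_two (by omega) (by omega) hX
  · exact fkOp_fkOp_eq_iff_of_weight_three (by omega) (by omega) hX
  · exact fkOp_fkOp_eq_iff_of_weight_four (by omega) (by omega) hX

end OddSym
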